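/- Let G be a finite simple graph on [r] = {1,…,r} with r ≥ 3 and no isolated vertices, and suppose G contains no compact vertices (a vertex is compact if it has degree ≥ 3 and lies in a triangle of G). Then for every n ≥ 2, there exists a ∈ ℕ^r with |a| = 2n − 1 such that the complex Δ_a(I_G^n) is disconnected if and only if there exist distinct non-adjacent vertices p and q of G with |N_p ∩ N_q| ≥ 3. -/

import Mathlib

open MvPolynomial

/-- The Stanley–Reisner ideal of a graph viewed as a one-dimensional simplicial complex. -/
noncomputable def SRIdeal (K : Type*) [Field K] {r : ℕ} (G : SimpleGraph (Fin r)) :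
    Ideal (MvPolynomial (Fin r) K) :=
  Ideal.span
    ({p | ∃ i j : Fin r, i ≠ j ∧ ¬ G.Adj i j ∧ p = X i * X j} ∪
     {p | ∃ i j k : Fin r, i ≠ j ∧ i ≠ k ∧ j ≠ k ∧ p = X i * X j * X k})

/-- Monomial localization `I_G[F]S`. -/
noncomputable def locSR (K : Type*) [Field K] {r : ℕ} (G : SimpleGraph (Fin r))
    (F : Finset (Fin r)) : Ideal (MvPolynomial (Fin r) K) :=
  Ideal.map (aeval (fun i : Fin r => if i ∈ F then 1 else X i) :
      MvPolynomial (Fin r) K →ₐ[K] MvPolynomial (Fin r) K) (SRIdeal K G)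

/-- `p` is a vertex of the degree complex `Δ_a(I_G^n)`. -/
def DeltaVert (K : Type*) [Field K] {r : ℕ} (G : SimpleGraph (Fin r))
    (n : ℕ) (a : Fin r → ℕ) (p : Fin r) : Prop :=
  (∏ i, (X i : MvPolynomial (Fin r) K) ^ a i) ∉ (locSR K G {p}) ^ n

/-- `{p,q}` is an edge of the degree complex `Δ_a(I_G^n)`. -/
def DeltaEdge (K : Type*) [Field K] {r : ℕ} (G : SimpleGraph (Fin r))
    (n : ℕ) (a : Fin r → ℕ) (p q : Fin r) : Prop :=
  p ≠ q ∧ (∏ i, (X i : MvPolynomial (Fin r) K) ^ a i) ∉ (locSR K G {p, q}) ^ n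

/-- The degree complex `Δ_a(I_G^n)` is disconnected: two of its vertices cannot be joined
by a path consisting of its edges. -/
def DeltaDisconnected (K : Type*) [Field K] {r : ℕ} (G : SimpleGraph (Fin r))
    (n : ℕ) (a : Fin r → ℕ) : Prop :=
  ∃ p q : Fin r, DeltaVert K G n a p ∧ DeltaVert K G n a q ∧
    ¬ ∃ (ℓ : ℕ) (f : ℕ → Fin r), f 0 = p ∧ f ℓ = q ∧
        ∀ i < ℓ, DeltaEdge K G n a (f i) (f (i + 1))

/-- A vertex of `G` is compact if it has degree `≥ 3` and lies in a triangle. -/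
def IsCompactVertex {r : ℕ} (G : SimpleGraph (Fin r)) [DecidableRel G.Adj]
    (v : Fin r) : Prop :=
  3 ≤ G.degree v ∧ ∃ x y : Fin r, G.Adj v x ∧ G.Adj v y ∧ G.Adj x y

section Localization

variable {K : Type*} [Field K] {r : ℕ} {G : SimpleGraph (Fin r)}

/-- Monomials whose weight is less than `c * n` lie outside the `n`-th power of a localization,
if the weight vanishes on the inverted variables and every generator has weight at least `c`. -/
lemma prod_notMem_locSR_pow {F : Finset (Fin r)} {w : Fin r → ℕ} {c n : ℕ} {a : Fin r → ℕ}
    (hF : ∀ i ∈ F, w i = 0) (h2 : ∀ i j, i ≠ j → ¬ G.Adj i j → c ≤ w i + w j)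
    (h3 : ∀ i j k, i ≠ j → i ≠ k → j ≠ k → c ≤ w i + w j + w k)
    (ha : ∑ i, w i * a i < c * n) :
    (∏ i, (X i : MvPolynomial (Fin r) K) ^ a i) ∉ (locSR K G F) ^ n := by
  intro hmem
  let φ : MvPolynomial (Fin r) K →ₐ[K] Polynomial K :=
    aeval (fun i => (Polynomial.X : Polynomial K) ^ w i)
  have hφ (i : Fin r) : φ (X i) = Polynomial.X ^ w i := aeval_X _ _
  have hcomp : φ.comp (aeval (fun i : Fin r => if i ∈ F then 1 else X i)) = φ := by
    refine MvPolynomial.algHom_ext fun i => ?_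
    by_cases hi : i ∈ F
    · simp [hi, hφ, hF i hi]
    · simp [hi]
  have hle : (locSR K G F).map φ ≤ Ideal.span {(Polynomial.X : Polynomial K) ^ c} := by
    rw [locSR, Ideal.map_le_iff_le_comap, Ideal.map_le_iff_le_comap, SRIdeal, Ideal.span_le]
    intro g hg
    have hφg : φ (aeval (fun i : Fin r => if i ∈ F then 1 else X i) g) = φ g :=
      DFunLike.congr_fun hcomp g
    rw [SetLike.mem_coe, Ideal.mem_comap, Ideal.mem_comap, hφg, Ideal.mem_span_singleton]
    rcases hg with ⟨i, j, hij, hadj, rfl⟩ | ⟨i, j, k, hij, hik, hjk, rfl⟩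
    · rw [map_mul, hφ, hφ, ← pow_add]
      exact pow_dvd_pow _ (h2 i j hij hadj)
    · rw [map_mul, map_mul, hφ, hφ, hφ, ← pow_add, ← pow_add]
      exact pow_dvd_pow _ (h3 i j k hij hik hjk)
  have h := Ideal.mem_map_of_mem φ hmem
  rw [Ideal.map_pow] at h
  have h' := Ideal.pow_right_mono hle n h
  rw [Ideal.span_singleton_pow, Ideal.mem_span_singleton, map_prod] at h'
  simp only [map_pow, hφ, ← pow_mul, Finset.prod_pow_eq_pow_sum] at h'
  rw [pow_dvd_pow_iff Polynomial.X_ne_zero Polynomial.not_isUnit_X] at h'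
  omega

lemma aeval_mem_locSR (F : Finset (Fin r)) {g : MvPolynomial (Fin r) K} (hg : g ∈ SRIdeal K G) :
    aeval (fun i : Fin r => if i ∈ F then (1 : MvPolynomial (Fin r) K) else X i) g
      ∈ locSR K G F :=
  Ideal.mem_map_of_mem _ hg

lemma X_mul_X_mem_SRIdeal {i j : Fin r} (hij : i ≠ j) (h : ¬ G.Adj i j) :
    (X i * X j : MvPolynomial (Fin r) K) ∈ SRIdeal K G :=
  Ideal.subset_span (Or.inl ⟨i, j, hij, h, rfl⟩)

lemma X_mul_X_mul_X_mem_SRIdeal {i j k : Fin r} (hij : i ≠ j) (hik : i ≠ k) (hjk : j ≠ k) :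
    (X i * X j * X k : MvPolynomial (Fin r) K) ∈ SRIdeal K G :=
  Ideal.subset_span (Or.inr ⟨i, j, k, hij, hik, hjk, rfl⟩)

lemma X_mem_locSR_singleton {p j : Fin r} (hj : j ≠ p) (h : ¬ G.Adj p j) :
    (X j : MvPolynomial (Fin r) K) ∈ locSR K G {p} := by
  simpa [hj] using aeval_mem_locSR {p} (X_mul_X_mem_SRIdeal (K := K) hj.symm h)

lemma X_mul_X_mem_locSR_singleton {p j k : Fin r} (hj : j ≠ p) (hk : k ≠ p) (hjk : j ≠ k) :
    (X j * X k : MvPolynomial (Fin r) K) ∈ locSR K G {p} := by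
  simpa [hj, hk] using
    aeval_mem_locSR (G := G) {p} (X_mul_X_mul_X_mem_SRIdeal (K := K) hj.symm hk.symm hjk)

lemma locSR_pair_eq_top {p q : Fin r} (hpq : p ≠ q) (h : ¬ G.Adj p q) :
    locSR K G {p, q} = ⊤ := by
  rw [Ideal.eq_top_iff_one]
  simpa using aeval_mem_locSR {p, q} (X_mul_X_mem_SRIdeal (K := K) hpq h)

lemma X_mem_locSR_pair {p q j : Fin r} (hpq : p ≠ q) (hp : j ≠ p) (hq : j ≠ q) :
    (X j : MvPolynomial (Fin r) K) ∈ locSR K G {p, q} := by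
  simpa [hp, hq] using
    aeval_mem_locSR (G := G) {p, q} (X_mul_X_mul_X_mem_SRIdeal (K := K) hpq hp.symm hq.symm)

lemma prod_X_pow_add_single (a : Fin r → ℕ) (j : Fin r) :
    (∏ i, (X i : MvPolynomial (Fin r) K) ^ (a + Pi.single j 1 : Fin r → ℕ) i)
      = (∏ i, (X i : MvPolynomial (Fin r) K) ^ a i) * X j := by
  have h (i : Fin r) : (X i : MvPolynomial (Fin r) K) ^ (Pi.single j 1 : Fin r → ℕ) i
      = if i = j then X i else 1 := by
    by_cases hi : i = j <;> simp [hi]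
  simp only [Pi.add_apply, pow_add, Finset.prod_mul_distrib, h, Finset.prod_ite_eq',
    Finset.mem_univ, if_true]

end Localization

lemma exists_eq_add_single {r : ℕ} {a : Fin r → ℕ} {j : Fin r} (hj : 0 < a j) :
    ∃ b : Fin r → ℕ, a = b + Pi.single j 1 := by
  refine ⟨a - Pi.single j 1, (tsub_add_cancel_of_le ?_).symm⟩
  intro i
  rcases eq_or_ne i j with rfl | h
  · simpa using Nat.succ_le_of_lt hj
  · simp [h]

lemma sum_add_single {r : ℕ} (s : Finset (Fin r)) (a : Fin r → ℕ) (j : Fin r) :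
    ∑ i ∈ s, (a + Pi.single j 1 : Fin r → ℕ) i = ∑ i ∈ s, a i + if j ∈ s then 1 else 0 := by
  simp [Finset.sum_add_distrib]

section DegreeComplex

variable {K : Type*} [Field K] {r : ℕ} {G : SimpleGraph (Fin r)} [DecidableRel G.Adj]

/-- The vertices different from `p` and not adjacent to `p`. -/
def farFinset (G : SimpleGraph (Fin r)) [DecidableRel G.Adj] (p : Fin r) : Finset (Fin r) :=
  Finset.univ.filter fun i => i ≠ p ∧ ¬ G.Adj p i

lemma mem_farFinset {p i : Fin r} : i ∈ farFinset G p ↔ i ≠ p ∧ ¬ G.Adj p i := by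
  simp [farFinset]

lemma prod_mem_locSR_singleton_pow (p : Fin r) (n : ℕ) (a : Fin r → ℕ)
    (h1 : 2 * n ≤ ∑ i ∈ farFinset G p, a i + ∑ i ∈ Finset.univ.erase p, a i)
    (h2 : ∀ x, G.Adj p x → n + a x ≤ ∑ i ∈ Finset.univ.erase p, a i) :
    (∏ i, (X i : MvPolynomial (Fin r) K) ^ a i) ∈ (locSR K G {p}) ^ n := by
  induction n generalizing a with
  | zero => simp
  | succ n ih =>
    by_cases hfar : ∃ j ∈ farFinset G p, 0 < a j
    · obtain ⟨j, hj, haj⟩ := hfar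
      obtain ⟨b, rfl⟩ := exists_eq_add_single haj
      have hj' := mem_farFinset.1 hj
      rw [prod_X_pow_add_single, pow_succ]
      refine Ideal.mul_mem_mul (ih b ?_ ?_) (X_mem_locSR_singleton hj'.1 hj'.2)
      · rw [sum_add_single, sum_add_single] at h1
        simp only [hj, hj'.1, Finset.mem_erase, Finset.mem_univ, ne_eq, not_false_eq_true,
          and_self, if_true] at h1
        omega
      · intro x hx
        have h := h2 x hx
        rw [sum_add_single] at h
        simp only [hj'.1, Finset.mem_erase, Finset.mem_univ, ne_eq, not_false_eq_true,
          and_self, if_true, Pi.add_apply] at h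
        omega
    · push Not at hfar
      have hfar0 : ∑ i ∈ farFinset G p, a i = 0 :=
        Finset.sum_eq_zero fun i hi => Nat.le_zero.1 (hfar i hi)
      have hadj : ∀ i, i ≠ p → 0 < a i → G.Adj p i := by
        intro i hi hai
        by_contra hnot
        exact absurd (hfar i (mem_farFinset.2 ⟨hi, hnot⟩)) (by omega)
      have hne : (Finset.univ.erase p).Nonempty :=
        Finset.nonempty_of_sum_ne_zero (f := a) (by omega)
      obtain ⟨x, hx, hmax⟩ := Finset.exists_max_image _ a hne
      have hax : 0 < a x := by
        by_contra h0
        have : ∑ i ∈ Finset.univ.erase p, a i = 0 :=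
          Finset.sum_eq_zero fun i hi => by have := hmax i hi; omega
        omega
      have hxp := Finset.ne_of_mem_erase hx
      have hsplit := Finset.add_sum_erase _ a hx
      have h2x := h2 x (hadj x hxp hax)
      obtain ⟨y, hy, hay⟩ := Finset.exists_ne_zero_of_sum_ne_zero
        (s := (Finset.univ.erase p).erase x) (f := a) (by omega)
      have hyx := Finset.ne_of_mem_erase hy
      have hyp := Finset.ne_of_mem_erase (Finset.mem_of_mem_erase hy)
      have hsplit' := Finset.add_sum_erase _ a hy
      have hthird : ∀ z, z ≠ p → z ≠ x → z ≠ y →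
          a x + a y + a z ≤ ∑ i ∈ Finset.univ.erase p, a i := by
        intro z hzp hzx hzy
        have := Finset.single_le_sum (f := a) (fun _ _ => Nat.zero_le _)
          (show z ∈ ((Finset.univ.erase p).erase x).erase y by simp [hzp, hzx, hzy])
        omega
      obtain ⟨b, rfl⟩ := exists_eq_add_single hax
      have hby : 0 < b y := by
        simpa [Pi.single_apply, hyx, Nat.pos_iff_ne_zero] using hay
      obtain ⟨c, rfl⟩ := exists_eq_add_single hby
      rw [prod_X_pow_add_single, prod_X_pow_add_single, mul_assoc, pow_succ]
      have hsum : ∑ i ∈ Finset.univ.erase p, (c + Pi.single y 1 + Pi.single x 1 : Fin r → ℕ) i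
          = ∑ i ∈ Finset.univ.erase p, c i + 2 := by
        rw [sum_add_single, sum_add_single]
        simp [hxp, hyp]
      rw [hsum] at h1 h2 hthird
      refine Ideal.mul_mem_mul (ih c (by omega) ?_)
        (X_mul_X_mem_locSR_singleton hyp hxp hyx)
      intro z hz
      have h2z := h2 z hz
      have hmz := hmax z (by simp [hz.ne'])
      rcases eq_or_ne z x with rfl | hzx
      · simp [hyx.symm] at h2z
        omega
      rcases eq_or_ne z y with rfl | hzy
      · simp [hzx] at h2z
        omega
      have h3 := hthird z hz.ne' hzx hzy
      simp [hzx, hzy, hyx, hyx.symm] at h2z hmz h3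
      omega

lemma sum_eq_add_far_add_neighbor (a : Fin r → ℕ) (p : Fin r) :
    ∑ i, a i = a p + ∑ i ∈ farFinset G p, a i + ∑ i ∈ G.neighborFinset p, a i := by
  have hd : Disjoint (farFinset G p) (G.neighborFinset p) := by
    rw [Finset.disjoint_left]
    intro i hi
    simpa using (mem_farFinset.1 hi).2
  have hu : Finset.univ.erase p = farFinset G p ∪ G.neighborFinset p := by
    ext i
    simp only [Finset.mem_erase, Finset.mem_univ, Finset.mem_union, mem_farFinset,
      SimpleGraph.mem_neighborFinset, and_true]
    constructor
    · tauto
    · rintro (h | h)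
      exacts [h.1, h.ne']
  rw [← Finset.add_sum_erase _ a (Finset.mem_univ p), hu, Finset.sum_union hd, add_assoc]

lemma DeltaVert.far_le_or_exists {n : ℕ} {a : Fin r → ℕ} (ha : ∑ i, a i = 2 * n - 1)
    {p : Fin r} (h : DeltaVert K G n a p) :
    ∑ i ∈ farFinset G p, a i ≤ a p ∨ ∃ x, G.Adj p x ∧ n ≤ a p + a x := by
  by_contra! hcon
  have hs := Finset.add_sum_erase _ a (Finset.mem_univ p)
  refine h (prod_mem_locSR_singleton_pow p n a (by omega) fun x hx => ?_)
  have := hcon.2 x hx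
  omega

lemma deltaVert_of_far_le {n : ℕ} (hn : 1 ≤ n) {a : Fin r → ℕ} (ha : ∑ i, a i = 2 * n - 1)
    {p : Fin r} (h : ∑ i ∈ farFinset G p, a i ≤ a p) : DeltaVert K G n a p := by
  refine prod_notMem_locSR_pow (c := 2)
    (w := fun i => if i = p then 0 else if G.Adj p i then 1 else 2) ?_ ?_ ?_ ?_
  · simp
  · intro i j hij hadj
    by_cases hi : i = p
    · subst hi
      simp [hij.symm, hadj]
    · by_cases hj : j = p
      · subst hj
        simp [hi, G.adj_comm, hadj]
      · simp only [hi, hj, if_false]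
        split_ifs <;> omega
  · intro i j k hij hik hjk
    split_ifs <;> omega
  · have hw : ∀ i, (if i = p then 0 else if G.Adj p i then 1 else 2) * a i
        + (if i = p then a i else 0) = a i + if i ∈ farFinset G p then a i else 0 := by
      intro i
      by_cases hi : i = p
      · simp [mem_farFinset, hi]
      · by_cases hadj : G.Adj p i <;> simp [mem_farFinset, hi, hadj, two_mul]
    have := Finset.sum_congr rfl fun i (_ : i ∈ Finset.univ) => hw i
    rw [Finset.sum_add_distrib, Finset.sum_add_distrib, Finset.sum_ite_eq',
      Finset.sum_ite_mem, Finset.univ_inter, if_pos (Finset.mem_univ p)] at this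
    omega

lemma deltaEdge_iff {n : ℕ} (hn : 1 ≤ n) {a : Fin r → ℕ} (ha : ∑ i, a i = 2 * n - 1)
    {p q : Fin r} : DeltaEdge K G n a p q ↔ G.Adj p q ∧ n ≤ a p + a q := by
  have hs (hpq : p ≠ q) :
      a p + a q + ∑ i ∈ (Finset.univ.erase p).erase q, a i = 2 * n - 1 := by
    rw [← ha, ← Finset.add_sum_erase _ a (Finset.mem_univ p),
      ← Finset.add_sum_erase _ a (show q ∈ Finset.univ.erase p by simp [hpq.symm]), add_assoc]
  constructor
  · rintro ⟨hpq, hmem⟩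
    by_contra hcon
    by_cases hadj : G.Adj p q
    · have hlt : a p + a q < n := not_le.1 fun h => hcon ⟨hadj, h⟩
      have hs := hs hpq
      apply hmem
      have hle : n ≤ ∑ i ∈ (Finset.univ.erase p).erase q, a i := by omega
      refine Ideal.pow_le_pow_right hle ?_
      rw [← Finset.prod_sdiff (Finset.subset_univ ((Finset.univ.erase p).erase q)),
        ← Finset.prod_pow_eq_pow_sum]
      refine Ideal.mul_mem_left _ _ (Ideal.prod_mem_prod fun i hi => Ideal.pow_mem_pow ?_ _)
      simp only [Finset.mem_erase, Finset.mem_univ, and_true] at hi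
      exact X_mem_locSR_pair hpq hi.2 hi.1
    · exact hmem (by simp [locSR_pair_eq_top hpq hadj, Ideal.top_pow])
  · rintro ⟨hadj, hle⟩
    have hs := hs hadj.ne
    refine ⟨hadj.ne, prod_notMem_locSR_pow (c := 1)
      (w := fun i => if i ∈ (Finset.univ.erase p).erase q then 1 else 0) ?_ ?_ ?_ ?_⟩
    · simp
    · intro i j hij hnot
      by_contra! hlt
      have h1 : i = q ∨ i = p := by by_contra! h; simp [h.1, h.2] at hlt
      have h2 : j = q ∨ j = p := by by_contra! h; simp [h.1, h.2] at hlt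
      rcases h1 with rfl | rfl <;> rcases h2 with rfl | rfl
      exacts [hij rfl, hnot hadj.symm, hnot hadj, hij rfl]
    · intro i j k hij hik hjk
      by_contra! hlt
      have h1 : i = q ∨ i = p := by by_contra! h; simp [h.1, h.2] at hlt
      have h2 : j = q ∨ j = p := by by_contra! h; simp [h.1, h.2] at hlt
      have h3 : k = q ∨ k = p := by by_contra! h; simp [h.1, h.2] at hlt
      grind
    · simp only [ite_mul, one_mul, zero_mul, Finset.sum_ite_mem, Finset.univ_inter]
      omega

end DegreeComplex

section Combinatorics

variable {r : ℕ} {G : SimpleGraph (Fin r)} [DecidableRel G.Adj] {n : ℕ} {a : Fin r → ℕ}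

lemma three_le_card_of_le_sum {p : Fin r} (hiso : ∃ w, G.Adj p w)
    (hp : ∀ x, G.Adj p x → a p + a x < n) {s : Finset (Fin r)} (hs : s ⊆ G.neighborFinset p)
    (hsum : 2 * n ≤ 2 * a p + ∑ i ∈ s, a i + 1) : 3 ≤ s.card := by
  obtain ⟨w, hw⟩ := hiso
  have hpw := hp w hw
  have hle : ∑ i ∈ s, a i ≤ s.card * (n - 1 - a p) := by
    refine Finset.sum_le_card_nsmul s a _ fun i hi => ?_
    have := hp i (by simpa using hs hi)
    omega
  by_contra! hlt
  have : s.card * (n - 1 - a p) ≤ 2 * (n - 1 - a p) := Nat.mul_le_mul_right _ (by omega)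
  omega

lemma not_adj_of_isolated (hcomp : ∀ v, ¬ IsCompactVertex G v) (ha : ∑ i, a i = 2 * n - 1)
    {p : Fin r} (hiso : ∃ w, G.Adj p w) (hp : ∀ x, G.Adj p x → a p + a x < n)
    (hfar : ∑ i ∈ farFinset G p, a i ≤ a p) {x y : Fin r} (hx : G.Adj p x) (hy : G.Adj p y) :
    ¬ G.Adj x y := by
  intro hxy
  refine hcomp p ⟨?_, x, y, hx, hy, hxy⟩
  rw [← G.card_neighborFinset_eq_degree]
  refine three_le_card_of_le_sum hiso hp subset_rfl ?_
  have := sum_eq_add_far_add_neighbor (G := G) a p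
  omega

/-- If `p` is an isolated vertex of the degree complex then so is every other vertex. -/
lemma lt_of_isolated (hcomp : ∀ v, ¬ IsCompactVertex G v) (ha : ∑ i, a i = 2 * n - 1)
    {p : Fin r} (hiso : ∃ w, G.Adj p w) (hp : ∀ x, G.Adj p x → a p + a x < n)
    (hfar : ∑ i ∈ farFinset G p, a i ≤ a p) {q y : Fin r} (hqp : q ≠ p) (hqy : G.Adj q y) :
    a q + a y < n := by
  have htri {x y : Fin r} (hx : G.Adj p x) (hy : G.Adj p y) : ¬ G.Adj x y :=
    not_adj_of_isolated hcomp ha hiso hp hfar hx hy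
  by_contra! hle
  have hyp : y ≠ p := by
    rintro rfl
    have := hp q hqy.symm
    omega
  obtain ⟨w, hw⟩ := hiso
  have hpw := hp w hw
  have hsub (s : Finset (Fin r)) (hs : s ⊆ farFinset G p) : ∑ i ∈ s, a i ≤ a p :=
    (Finset.sum_le_sum_of_subset hs).trans hfar
  by_cases hq : G.Adj p q
  · have h1 := hp q hq
    have h2 := hsub {y} (by simpa [mem_farFinset, hyp] using fun h => htri hq h hqy)
    simp at h2
    omega
  · by_cases hy : G.Adj p y
    · have h1 := hp y hy
      have h2 := hsub {q} (by simpa [mem_farFinset, hqp] using hq)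
      simp at h2
      omega
    · have h2 := hsub {q, y} (by
        simp [Finset.insert_subset_iff, mem_farFinset, hqp, hyp, hq, hy])
      rw [Finset.sum_pair hqy.ne] at h2
      omega

lemma common_neighbors_of_isolated (hcomp : ∀ v, ¬ IsCompactVertex G v)
    (ha : ∑ i, a i = 2 * n - 1) {p q : Fin r} (hpq : p ≠ q) (hiso : ∃ w, G.Adj p w)
    (hp : ∀ x, G.Adj p x → a p + a x < n)
    (hpfar : ∑ i ∈ farFinset G p, a i ≤ a p) (hqfar : ∑ i ∈ farFinset G q, a i ≤ a q) :
    ¬ G.Adj p q ∧ 3 ≤ (G.neighborFinset p ∩ G.neighborFinset q).card := by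
  have hsp := sum_eq_add_far_add_neighbor (G := G) a p
  have hadj : ¬ G.Adj p q := by
    intro hadj
    have hsub : G.neighborFinset p ⊆ insert q (farFinset G q) := by
      intro x hx
      rw [SimpleGraph.mem_neighborFinset] at hx
      rw [Finset.mem_insert, mem_farFinset]
      have := not_adj_of_isolated hcomp ha hiso hp hpfar hadj hx
      tauto
    have h1 := Finset.sum_le_sum_of_subset (f := a) hsub
    rw [Finset.sum_insert (by simp [mem_farFinset])] at h1
    have := hp q hadj
    omega
  have key (u v : Fin r) (huv : u ≠ v) (h : ¬ G.Adj u v) :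
      a v + ∑ i ∈ G.neighborFinset v \ G.neighborFinset u, a i ≤ ∑ i ∈ farFinset G u, a i := by
    rw [← Finset.sum_insert (by simp)]
    refine Finset.sum_le_sum_of_subset fun x hx => ?_
    rw [mem_farFinset]
    simp only [Finset.mem_insert, Finset.mem_sdiff, SimpleGraph.mem_neighborFinset] at hx
    rcases hx with rfl | hx
    · exact ⟨huv.symm, h⟩
    · refine ⟨?_, hx.2⟩
      rintro rfl
      exact h hx.1.symm
  have h1 := key p q hpq hadj
  have h2 := key q p hpq.symm fun h => hadj h.symm
  have h3 := Finset.sum_inter_add_sum_sdiff (G.neighborFinset p) (G.neighborFinset q) a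
  exact ⟨hadj, three_le_card_of_le_sum hiso hp Finset.inter_subset_left (by omega)⟩

/-- Two pairs of vertices whose exponents each sum to at least `n` share a vertex. -/
lemma eq_of_two_edges (hn : 1 ≤ n) (ha : ∑ i, a i = 2 * n - 1) {p x q y : Fin r}
    (hpq : p ≠ q) (hpx : p ≠ x) (hqy : q ≠ y) (h1 : n ≤ a p + a x) (h2 : n ≤ a q + a y) :
    x = q ∨ y = p ∨ x = y := by
  by_contra! hcon
  obtain ⟨hxq, hyp, hxy⟩ := hcon
  have h := Finset.sum_le_sum_of_subset (f := a) (Finset.subset_univ {p, x, q, y})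
  rw [Finset.sum_insert (by simp [hpq, hpx, hyp.symm]), Finset.sum_insert (by simp [hxq, hxy]),
    Finset.sum_pair hqy] at h
  omega

end Combinatorics

lemma exists_path_of_common {r : ℕ} {R : Fin r → Fin r → Prop} {p x q : Fin r}
    (h1 : R p x) (h2 : R x q) :
    ∃ (ℓ : ℕ) (f : ℕ → Fin r), f 0 = p ∧ f ℓ = q ∧ ∀ i < ℓ, R (f i) (f (i + 1)) := by
  refine ⟨2, fun i => if i = 0 then p else if i = 1 then x else q, by simp, by simp, ?_⟩
  intro i hi
  interval_cases i <;> simpa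

lemma exists_path_of_rel {r : ℕ} {R : Fin r → Fin r → Prop} {p q : Fin r} (h : R p q) :
    ∃ (ℓ : ℕ) (f : ℕ → Fin r), f 0 = p ∧ f ℓ = q ∧ ∀ i < ℓ, R (f i) (f (i + 1)) := by
  refine ⟨1, fun i => if i = 0 then p else q, by simp, by simp, ?_⟩
  intro i hi
  interval_cases i
  simpa

theorem stmt_17 (K : Type*) [Field K] {r : ℕ} (hr : 3 ≤ r) (G : SimpleGraph (Fin r))
    [DecidableRel G.Adj]
    (hiso : ∀ v : Fin r, ∃ w : Fin r, G.Adj v w)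
    (hcomp : ∀ v : Fin r, ¬ IsCompactVertex G v)
    (n : ℕ) (hn : 2 ≤ n) :
    (∃ a : Fin r → ℕ, (∑ i, a i) = 2 * n - 1 ∧ DeltaDisconnected K G n a) ↔
      ∃ p q : Fin r, p ≠ q ∧ ¬ G.Adj p q ∧
        3 ≤ (G.neighborFinset p ∩ G.neighborFinset q).card := by
  have hn1 : 1 ≤ n := by omega
  constructor
  · rintro ⟨a, ha, p, q, hp, hq, hpath⟩
    have hpq : p ≠ q := by
      rintro rfl
      exact hpath ⟨0, fun _ => p, rfl, rfl, by simp⟩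
    have hedge {u v : Fin r} (h : G.Adj u v) (hle : n ≤ a u + a v) : DeltaEdge K G n a u v :=
      (deltaEdge_iff hn1 ha).2 ⟨h, hle⟩
    have hisolated : (∀ x, G.Adj p x → a p + a x < n) ∨ ∀ y, G.Adj q y → a q + a y < n := by
      by_contra! hcon
      obtain ⟨⟨x, hx, hpx⟩, y, hy, hqy⟩ := hcon
      rcases eq_of_two_edges hn1 ha hpq hx.ne hy.ne hpx hqy with rfl | rfl | rfl
      · exact hpath (exists_path_of_rel (hedge hx hpx))
      · exact hpath (exists_path_of_rel (hedge hy.symm (by omega)))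
      · exact hpath (exists_path_of_common (hedge hx hpx) (hedge hy.symm (by omega)))
    have main {u v : Fin r} (huv : u ≠ v) (hu : DeltaVert K G n a u) (hv : DeltaVert K G n a v)
        (h : ∀ x, G.Adj u x → a u + a x < n) : ∃ p q : Fin r, p ≠ q ∧ ¬ G.Adj p q ∧
          3 ≤ (G.neighborFinset p ∩ G.neighborFinset q).card := by
      have hufar := (hu.far_le_or_exists ha).resolve_right fun ⟨x, hx, hle⟩ =>
        absurd (h x hx) (not_lt.2 hle)
      have hvfar := (hv.far_le_or_exists ha).resolve_right fun ⟨x, hx, hle⟩ =>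
        absurd (lt_of_isolated hcomp ha (hiso u) h hufar huv.symm hx) (not_lt.2 hle)
      exact ⟨u, v, huv, common_neighbors_of_isolated hcomp ha huv (hiso u) h hufar hvfar⟩
    rcases hisolated with h | h
    exacts [main hpq hp hq h, main hpq.symm hq hp h]
  · rintro ⟨p, q, hpq, hnadj, hcard⟩
    obtain ⟨s, hs, hs3⟩ := Finset.exists_subset_card_eq hcard
    have hsp : ∀ x ∈ s, G.Adj p x := fun x hx => by
      simpa using Finset.mem_of_mem_inter_left (hs hx)
    have hsq : ∀ x ∈ s, G.Adj q x := fun x hx => by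
      simpa using Finset.mem_of_mem_inter_right (hs hx)
    have hps : p ∉ s := fun h => (hsp p h).ne rfl
    have hqs : q ∉ s := fun h => (hsq q h).ne rfl
    have hdeg : 3 ≤ G.degree p := by
      rw [← G.card_neighborFinset_eq_degree]
      exact hcard.trans (Finset.card_le_card Finset.inter_subset_left)
    have hind : ∀ x ∈ s, ∀ y ∈ s, ¬ G.Adj x y := fun x hx y hy hxy =>
      hcomp p ⟨hdeg, x, y, hsp x hx, hsp y hy, hxy⟩
    let a : Fin r → ℕ := fun i =>
      (if i = p then n - 2 else 0) + (if i = q then n - 2 else 0) + if i ∈ s then 1 else 0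
    have hsum (t : Finset (Fin r)) : ∑ i ∈ t, a i =
        (if p ∈ t then n - 2 else 0) + (if q ∈ t then n - 2 else 0) + (t ∩ s).card := by
      simp [a, Finset.sum_add_distrib]
    have ha : ∑ i, a i = 2 * n - 1 := by
      rw [hsum, Finset.univ_inter, hs3]
      simp only [Finset.mem_univ, if_true]
      omega
    have hnoedge (u v : Fin r) : ¬ DeltaEdge K G n a u v := by
      rw [deltaEdge_iff hn1 ha]
      rintro ⟨huv, hle⟩
      have := huv.ne
      have := huv.symm
      have := fun hu hv => hind u hu v hv huv
      dsimp only [a] at hle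
      grind
    have hfar (t : Fin r) (ht : ∀ x ∈ s, G.Adj t x) : farFinset G t ∩ s = ∅ := by
      rw [← Finset.disjoint_iff_inter_eq_empty, Finset.disjoint_left]
      exact fun x hx hxs => (mem_farFinset.1 hx).2 (ht x hxs)
    refine ⟨a, ha, p, q, deltaVert_of_far_le hn1 ha ?_, deltaVert_of_far_le hn1 ha ?_, ?_⟩
    · rw [hsum, hfar p hsp]
      simp [mem_farFinset, hpq.symm, hnadj, a, hpq, hps]
    · rw [hsum, hfar q hsq]
      simp [mem_farFinset, hpq.symm, G.adj_comm q p, hnadj, a, hpq, hqs]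
    · rintro ⟨ℓ, f, h0, hl, hstep⟩
      rcases Nat.eq_zero_or_pos ℓ with rfl | hpos
      · exact hpq (h0.symm.trans hl)
      · exact hnoedge _ _ (hstep 0 hpos)
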